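/- arXiv:2204.04626 — 4 statements merged into one kernel-verified Lean document; each statement's English description precedes it below -/
import Mathlib

section
/- Let u, v ∈ ℤ² with |det(u,v)| = 1, let R = conv{(0,0), u, v, u+v} (a lattice parallelogram of area 1), and let P ⊂ ℤ² ∩ [0,∞)² be a finite set containing a lattice translate of the set of lattice points of 5R. Then for a generic polynomial f ∈ ℂ^P, the curve {f=0} has no tritangent: there exist no nondegenerate line L and three pairwise distinct points p₁, p₂, p₃ ∈ L ∩ T such that L is tangent to {f=0} at each pᵢ. -/
open scoped Pointwise
open MvPolynomial

noncomputable section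

/-- The torus `(ℂ ∖ {0})²`. -/
def Torus : Set (ℂ × ℂ) := {p | p.1 ≠ 0 ∧ p.2 ≠ 0}

/-- Evaluation of a bivariate polynomial at a point of `ℂ²`. -/
def evalP (f : MvPolynomial (Fin 2) ℂ) (p : ℂ × ℂ) : ℂ :=
  MvPolynomial.eval (fun i => if i = 0 then p.1 else p.2) f

/-- The affine line through `p` with direction `w`, as a subset of `ℂ²`. -/
def lineThrough (p w : ℂ × ℂ) : Set (ℂ × ℂ) :=
  {q | ∃ t : ℂ, q = (p.1 + t * w.1, p.2 + t * w.2)}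

/-- The univariate polynomial `t ↦ f (p + t • w)`. -/
def lineRestrict (f : MvPolynomial (Fin 2) ℂ) (p w : ℂ × ℂ) : Polynomial ℂ :=
  MvPolynomial.aeval
    (fun i => if i = 0 then Polynomial.C p.1 + Polynomial.C w.1 * Polynomial.X
              else Polynomial.C p.2 + Polynomial.C w.2 * Polynomial.X) f

/-- Intersection multiplicity at `p` of the curve `{f = 0}` and the line through `p`
with direction `w` (as `ℕ∞`; it is `⊤` if the line lies inside the curve). -/
def interMult (f : MvPolynomial (Fin 2) ℂ) (p w : ℂ × ℂ) : ℕ∞ :=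
  if lineRestrict f p w = 0 then ⊤
  else (Polynomial.rootMultiplicity 0 (lineRestrict f p w) : ℕ∞)

/-- The point of `ℝ²` corresponding to a lattice point. -/
def rpt (k : ℤ × ℤ) : ℝ × ℝ := ((k.1 : ℝ), (k.2 : ℝ))

/-- The support of `f` is contained in `S ⊆ ℤ²`. -/
def SuppIn (f : MvPolynomial (Fin 2) ℂ) (S : Set (ℤ × ℤ)) : Prop :=
  ∀ m ∈ f.support, ((m 0 : ℤ), (m 1 : ℤ)) ∈ S

/-- The coefficient of `f` at the exponent `k ∈ ℤ²`. -/
def coeffAt (f : MvPolynomial (Fin 2) ℂ) (k : ℤ × ℤ) : ℂ :=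
  if 0 ≤ k.1 ∧ 0 ≤ k.2 then
    f.coeff (Finsupp.single (0 : Fin 2) k.1.toNat + Finsupp.single (1 : Fin 2) k.2.toNat)
  else 0

/-- A property `Q` holds for a generic polynomial supported in `S`: there is a nonzero
polynomial `D` in variables indexed by `S` such that `Q f` holds for every `f` with
support in `S` whose coefficient tuple is not annihilated by `D`. -/
def GenericOn (S : Set (ℤ × ℤ)) (Q : MvPolynomial (Fin 2) ℂ → Prop) : Prop :=
  ∃ D : MvPolynomial S ℂ, D ≠ 0 ∧
    ∀ f : MvPolynomial (Fin 2) ℂ, SuppIn f S →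
      MvPolynomial.eval (fun k => coeffAt f k.1) D ≠ 0 → Q f

/-- `P` is a lattice polygon: the convex hull of finitely many lattice points. -/
def IsLatticePolygon (P : Set (ℝ × ℝ)) : Prop :=
  ∃ V : Finset (ℤ × ℤ), V.Nonempty ∧ P = convexHull ℝ (rpt '' (V : Set (ℤ × ℤ)))

/-- The standard triangle `Δ = conv {(0,0), (1,0), (0,1)}`. -/
def stdTriangle : Set (ℝ × ℝ) := convexHull ℝ {(0, 0), (1, 0), (0, 1)}

/-- The lattice points of a subset of `ℝ²`. -/
def latticePts (P : Set (ℝ × ℝ)) : Set (ℤ × ℤ) := {k | rpt k ∈ P}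

/-- The support set (face) of `P` in the direction of the covector `γ`. -/
def face (P : Set (ℝ × ℝ)) (γ : ℤ × ℤ) : Set (ℝ × ℝ) :=
  {p ∈ P | ∀ q ∈ P, (γ.1 : ℝ) * q.1 + (γ.2 : ℝ) * q.2 ≤ (γ.1 : ℝ) * p.1 + (γ.2 : ℝ) * p.2}

/-- The lattice length of the face of `P` in direction `γ`. -/
def lenFace (P : Set (ℝ × ℝ)) (γ : ℤ × ℤ) : ℕ := (latticePts (face P γ)).ncard - 1

/-- The Euclidean area of a subset of `ℝ²`. -/
def areaOf (P : Set (ℝ × ℝ)) : ℝ := (MeasureTheory.volume P).toReal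

/-- The set of inflection points of `{f = 0}` in the torus. -/
def inflPts (f : MvPolynomial (Fin 2) ℂ) : Set (ℂ × ℂ) :=
  {p | p ∈ Torus ∧ evalP f p = 0 ∧ ∃ w : ℂ × ℂ, w ≠ 0 ∧ 3 ≤ interMult f p w}

/-- The set of lines (as subsets of `ℂ²`) tangent to `{f = 0}` at two distinct
points of the torus. -/
def bitangentLines (f : MvPolynomial (Fin 2) ℂ) : Set (Set (ℂ × ℂ)) :=
  {l | ∃ p w q₁ q₂ : ℂ × ℂ, w ≠ 0 ∧ l = lineThrough p w ∧
    q₁ ∈ lineThrough p w ∩ Torus ∧ q₂ ∈ lineThrough p w ∩ Torus ∧ q₁ ≠ q₂ ∧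
    2 ≤ interMult f q₁ w ∧ 2 ≤ interMult f q₂ w}

/-- `P` contains a lattice translate of `5Δ`. -/
def Contains5Delta (P : Set (ℝ × ℝ)) : Prop :=
  ∃ t : ℤ × ℤ, rpt t +ᵥ ((5 : ℝ) • stdTriangle) ⊆ P

open scoped Matrix

theorem exists_polynomial_vanishing_on_rational_image {K : Type} [Field K] {σ ι : Type}
    [Fintype σ] [Fintype ι] (hcard : Fintype.card σ < Fintype.card ι)
    (n : ι → MvPolynomial σ K) (d : MvPolynomial σ K) :
    ∃ D : MvPolynomial ι K, D ≠ 0 ∧ ∀ (z : σ → K) (a : ι → K), eval z d ≠ 0 →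
      (∀ i, eval z (n i) = eval z d * a i) → eval a D = 0 := by
  by_cases hd : d = 0
  · exact ⟨1, one_ne_zero, fun z a hz => absurd (by simp [hd]) hz⟩
  have : IsDomain (Localization.Away d) := IsLocalization.Away.isDomain (Localization.Away d) hd
  have hinj : Function.Injective (algebraMap (MvPolynomial σ K) (Localization.Away d)) :=
    IsLocalization.injective _ (powers_le_nonZeroDivisors_of_noZeroDivisors hd)
  have : FaithfulSMul (MvPolynomial σ K) (Localization.Away d) :=
    (faithfulSMul_iff_algebraMap_injective _ _).2 hinj
  have halg : Algebra.IsAlgebraic (MvPolynomial σ K) (Localization.Away d) :=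
    IsLocalization.isAlgebraic _ (Submonoid.powers d)
  have htr : Algebra.trdeg K (Localization.Away d) = Fintype.card σ := by
    rw [← trdeg_add_eq K (MvPolynomial σ K),
      trdeg_eq_zero (R := MvPolynomial σ K) (A := Localization.Away d), add_zero,
      MvPolynomial.trdeg_of_isDomain]
    simp
  let y : ι → Localization.Away d := fun i =>
    algebraMap _ _ (n i) * IsLocalization.Away.invSelf d
  have hdep : ¬ AlgebraicIndependent K y := fun h => by
    have := h.cardinalMk_le_trdeg
    rw [htr, Cardinal.mk_fintype, Nat.cast_le] at this
    omega
  rw [algebraicIndependent_iff] at hdep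
  push Not at hdep
  obtain ⟨D, hD, hD0⟩ := hdep
  refine ⟨D, hD0, fun z a hz hn => ?_⟩
  let φ : Localization.Away d →ₐ[K] K :=
    IsLocalization.Away.liftAlgHom d (f := aeval z) (by simpa using hz)
  have hφ (p : MvPolynomial σ K) : φ (algebraMap _ _ p) = eval z p := by
    simp [φ, IsLocalization.Away.liftAlgHom_apply]
  have hya : φ ∘ y = a := by
    funext i
    have h := congrArg φ (IsLocalization.Away.mul_invSelf (S := Localization.Away d) d)
    rw [map_mul, map_one, hφ] at h
    simp only [Function.comp_apply, y, map_mul, hφ, hn]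
    linear_combination a i * h
  have := congrArg φ hD
  rw [map_zero, MvPolynomial.comp_aeval_apply] at this
  change aeval (φ ∘ y) D = 0 at this
  rwa [hya, MvPolynomial.aeval_eq_eval] at this

theorem exists_polynomial_vanishing_on_block_kernels {K : Type} [Field K] {σ κ ρ : Type}
    [Fintype σ] [Fintype κ] [DecidableEq κ] [Fintype ρ]
    (hcard : Fintype.card σ < Fintype.card κ) (M : Matrix κ (κ ⊕ ρ) (MvPolynomial σ K)) :
    ∃ D : MvPolynomial (κ ⊕ ρ) K, D ≠ 0 ∧ ∀ (z : σ → K) (a : κ ⊕ ρ → K),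
      (M.map (eval z)).toCols₁.det ≠ 0 → M.map (eval z) *ᵥ a = 0 → eval a D = 0 := by
  let N : Matrix κ (κ ⊕ ρ) (MvPolynomial (σ ⊕ ρ) K) := M.map (rename Sum.inl)
  let d := N.toCols₁.det
  let n : κ ⊕ ρ → MvPolynomial (σ ⊕ ρ) K := Sum.elim
    (-(N.toCols₁.adjugate *ᵥ (N.toCols₂ *ᵥ fun r => X (Sum.inr r))))
    (fun r => d * X (Sum.inr r))
  obtain ⟨D, hD0, hD⟩ := exists_polynomial_vanishing_on_rational_image
    (by simpa using hcard) n d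
  refine ⟨D, hD0, fun z a hdet hker => ?_⟩
  let z' : σ ⊕ ρ → K := Sum.elim z (a ∘ Sum.inr)
  have hN : N.map (eval z') = M.map (eval z) := by
    ext i j
    simp [N, z', eval_rename, Sum.elim_comp_inl]
  have hd : eval z' d = (M.map (eval z)).toCols₁.det := by
    rw [← hN, RingHom.map_det]; rfl
  refine hD z' a (by rwa [hd]) ?_
  rintro (i | r)
  · have hker' : (M.map (eval z)).toCols₂ *ᵥ (a ∘ Sum.inr) =
        -((M.map (eval z)).toCols₁ *ᵥ (a ∘ Sum.inl)) := by
      rw [eq_neg_iff_add_eq_zero, add_comm, ← Matrix.fromCols_mulVec, Matrix.fromCols_toCols, hker]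
    have h1 : eval z' (n (Sum.inl i)) = (-((M.map (eval z)).toCols₁.adjugate *ᵥ
        ((M.map (eval z)).toCols₂ *ᵥ (a ∘ Sum.inr)))) i := by
      have hc1 : N.toCols₁.map (eval z') = (M.map (eval z)).toCols₁ := by rw [← hN]; rfl
      have hc2 : N.toCols₂.map (eval z') = (M.map (eval z)).toCols₂ := by rw [← hN]; rfl
      have hadj := RingHom.map_adjugate (eval z') N.toCols₁
      simp only [RingHom.mapMatrix_apply] at hadj
      rw [hc1] at hadj
      simp only [n, Sum.elim_inl, Pi.neg_apply, map_neg, RingHom.map_mulVec]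
      have hX : eval z' ∘ (N.toCols₂ *ᵥ fun r => X (Sum.inr r)) =
          (M.map (eval z)).toCols₂ *ᵥ (a ∘ Sum.inr) := by
        funext k
        simp only [Function.comp_apply, RingHom.map_mulVec, hc2]
        refine congrFun (congrArg _ (_root_.funext fun r => ?_)) k
        simp [z']
      rw [hadj, hX]
    rw [h1, hker', Matrix.mulVec_neg, neg_neg, Matrix.mulVec_mulVec, Matrix.adjugate_mul, hd]
    simp [Matrix.smul_mulVec]
  · simp [n, z']

theorem exists_polynomial_vanishing_on_kernels {K : Type} [Field K] {σ κ ι : Type}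
    [Fintype σ] [Fintype κ] [Fintype ι]
    (hcard : Fintype.card σ < Fintype.card κ) (M : Matrix κ ι (MvPolynomial σ K)) :
    ∃ D : MvPolynomial ι K, D ≠ 0 ∧ ∀ (z : σ → K) (a : ι → K),
      Submodule.span K (Set.range (M.map (eval z)).col) = ⊤ → M.map (eval z) *ᵥ a = 0 →
        eval a D = 0 := by
  classical
  let E (e : κ ↪ ι) : κ ⊕ ((Set.range e)ᶜ : Set ι) ≃ ι :=
    ((Equiv.ofInjective e e.injective).sumCongr (Equiv.refl _)).trans
      (Equiv.Set.sumCompl (Set.range e))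
  choose D hD0 hD using fun e : κ ↪ ι =>
    exists_polynomial_vanishing_on_block_kernels hcard (M.submatrix id (E e))
  refine ⟨∏ e, rename (E e) (D e), Finset.prod_ne_zero_iff.2 fun e _ => ?_,
    fun z a hspan hker => ?_⟩
  · rw [Ne, map_eq_zero_iff _ (rename_injective _ (E e).injective)]
    exact hD0 e
  obtain ⟨v, hv, -, hlin⟩ := Submodule.exists_fun_fin_finrank_span_eq K
    (Set.range (M.map (eval z)).col)
  have hrank : Module.finrank K (Submodule.span K (Set.range (M.map (eval z)).col)) =
      Fintype.card κ := by
    rw [hspan, finrank_top, Module.finrank_fintype_fun_eq_card]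
  let q : κ ≃ Fin (Module.finrank K (Submodule.span K (Set.range (M.map (eval z)).col))) :=
    Fintype.equivFinOfCardEq hrank.symm
  choose w hw using hv
  have hlin' : LinearIndependent K fun i => (M.map (eval z)).col (w (q i)) := by
    simp only [hw]
    exact hlin.comp q q.injective
  let e : κ ↪ ι := ⟨fun i => w (q i), fun i j hij => hlin'.injective (by simp only [hij])⟩
  rw [map_prod]
  refine Finset.prod_eq_zero (Finset.mem_univ e) ?_
  rw [eval_rename]
  refine hD e z _ ?_ ?_
  · rw [← isUnit_iff_ne_zero, ← Matrix.isUnit_iff_isUnit_det,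
      ← Matrix.linearIndependent_cols_iff_isUnit]
    exact hlin'
  · rw [← Matrix.submatrix_map, Matrix.submatrix_mulVec_equiv]
    simp [Function.comp_assoc, hker]

open TrivSqZeroExt

/-- The span of the products `g ^ i * h ^ j` with `i, j ≤ n`. -/
def bidegreeSpan (K : Type*) {A : Type*} [CommSemiring K] [CommSemiring A] [Algebra K A]
    (g h : A) (n : ℕ) : Submodule K A :=
  Submodule.span K {x | ∃ i ≤ n, ∃ j ≤ n, g ^ i * h ^ j = x}

section

variable {K A : Type*} [CommRing K] [CommRing A] [Algebra K A] {g h : A}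

theorem algebraMap_mem_bidegreeSpan (c : K) : algebraMap K A c ∈ bidegreeSpan K g h 1 := by
  rw [Algebra.algebraMap_eq_smul_one]
  exact Submodule.smul_mem _ _ (Submodule.subset_span ⟨0, by simp, 0, by simp, by simp⟩)

theorem left_mem_bidegreeSpan : g ∈ bidegreeSpan K g h 1 :=
  Submodule.subset_span ⟨1, le_rfl, 0, by simp, by simp⟩

theorem right_mem_bidegreeSpan : h ∈ bidegreeSpan K g h 1 :=
  Submodule.subset_span ⟨0, by simp, 1, le_rfl, by simp⟩

theorem mul_mem_bidegreeSpan {x y : A} {m n : ℕ} (hx : x ∈ bidegreeSpan K g h m)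
    (hy : y ∈ bidegreeSpan K g h n) : x * y ∈ bidegreeSpan K g h (m + n) := by
  have := Submodule.mul_mem_mul hx hy
  rw [bidegreeSpan, bidegreeSpan, Submodule.span_mul_span] at this
  refine Submodule.span_mono ?_ this
  rintro _ ⟨_, ⟨i, hi, j, hj, rfl⟩, _, ⟨i', hi', j', hj', rfl⟩, rfl⟩
  exact ⟨i + i', by omega, j + j', by omega, by ring⟩

end

/-- Polynomials of bidegree at most `(5, 5)` interpolate arbitrary first-order jets at three
distinct points. -/
theorem bidegreeSpan_jets_eq_top {K : Type*} [Field K] {g h : Fin 3 → DualNumber K}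
    (hsep : ∀ s t, s ≠ t → (g s).fst ≠ (g t).fst ∨ (h s).fst ≠ (h t).fst)
    (himm : ∀ s, (g s).snd ≠ 0 ∨ (h s).snd ≠ 0) : bidegreeSpan K g h 5 = ⊤ := by
  have hlin (s t : Fin 3) (hst : s ≠ t) :
      ∃ l ∈ bidegreeSpan K g h 1, (l t).fst = 0 ∧ (l s).fst ≠ 0 := by
    rcases hsep s t hst with H | H
    · exact ⟨g - algebraMap K _ (g t).fst, sub_mem left_mem_bidegreeSpan
        (algebraMap_mem_bidegreeSpan _), by simp [algebraMap_eq_inl], by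
          simpa [algebraMap_eq_inl, sub_eq_zero] using H⟩
    · exact ⟨h - algebraMap K _ (h t).fst, sub_mem right_mem_bidegreeSpan
        (algebraMap_mem_bidegreeSpan _), by simp [algebraMap_eq_inl], by
          simpa [algebraMap_eq_inl, sub_eq_zero] using H⟩
  have htan (s : Fin 3) : ∃ r ∈ bidegreeSpan K g h 1, (r s).fst = 0 ∧ (r s).snd ≠ 0 := by
    rcases himm s with H | H
    · exact ⟨g - algebraMap K _ (g s).fst, sub_mem left_mem_bidegreeSpan
        (algebraMap_mem_bidegreeSpan _), by simp [algebraMap_eq_inl], by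
          simpa [algebraMap_eq_inl] using H⟩
    · exact ⟨h - algebraMap K _ (h s).fst, sub_mem right_mem_bidegreeSpan
        (algebraMap_mem_bidegreeSpan _), by simp [algebraMap_eq_inl], by
          simpa [algebraMap_eq_inl] using H⟩
  have hsingle (s : Fin 3) (x : DualNumber K) :
      (Pi.single s x : Fin 3 → DualNumber K) ∈ bidegreeSpan K g h 5 := by
    obtain ⟨t, t', hst, hst', hcover⟩ :
        ∃ t t' : Fin 3, s ≠ t ∧ s ≠ t' ∧ ∀ i, i = s ∨ i = t ∨ i = t' := by
      revert s; decide
    obtain ⟨l, hl, hlt, hls⟩ := hlin s t hst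
    obtain ⟨l', hl', hlt', hls'⟩ := hlin s t' hst'
    obtain ⟨r, hr, hrs, hrs'⟩ := htan s
    let q := l * l * (l' * l')
    have hq : q ∈ bidegreeSpan K g h 4 :=
      mul_mem_bidegreeSpan (m := 2) (n := 2)
        (mul_mem_bidegreeSpan (m := 1) (n := 1) hl hl)
        (mul_mem_bidegreeSpan (m := 1) (n := 1) hl' hl')
    have hqt : q t = 0 := by
      ext <;> simp [q, hlt]
    have hqt' : q t' = 0 := by
      ext <;> simp [q, hlt']
    have hqs : (q s).fst ≠ 0 := by simp [q, hls, hls']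
    clear_value q
    obtain ⟨α, hα⟩ : ∃ α, α * (q s).fst = x.fst := ⟨x.fst / (q s).fst, by field_simp⟩
    obtain ⟨β, hβ⟩ : ∃ β, β * ((q s).fst * (r s).snd) = x.snd - α * (q s).snd :=
      ⟨(x.snd - α * (q s).snd) / ((q s).fst * (r s).snd), by field_simp⟩
    have hx : (Pi.single s x : Fin 3 → DualNumber K) =
        q * (algebraMap K _ α + β • r) := by
      funext i
      rcases hcover i with rfl | rfl | rfl
      · ext
        · simp [algebraMap_eq_inl, hrs, ← hα, mul_comm]
        · simp [algebraMap_eq_inl, hrs]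
          linear_combination -hβ
      · simp [hqt, hst.symm]
      · simp [hqt', hst'.symm]
    rw [hx]
    exact mul_mem_bidegreeSpan (m := 4) (n := 1) hq
      (add_mem (algebraMap_mem_bidegreeSpan α) (Submodule.smul_mem _ β hr))
  rw [eq_top_iff]
  intro x _
  rw [← Finset.univ_sum_single x]
  exact sum_mem fun s _ => hsingle s (x s)

/-- The Laurent monomial `x ^ k.1 * y ^ k.2`. -/
def laurentMonomial {G : Type*} [CommGroup G] (x y : G) (k : ℤ × ℤ) : G := x ^ k.1 * y ^ k.2

section

variable {G : Type*} [CommGroup G] (x y : G)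

theorem laurentMonomial_add (k l : ℤ × ℤ) :
    laurentMonomial x y (k + l) = laurentMonomial x y k * laurentMonomial x y l := by
  simp only [laurentMonomial, Prod.fst_add, Prod.snd_add, zpow_add]
  exact mul_mul_mul_comm _ _ _ _

theorem laurentMonomial_smul (n : ℕ) (k : ℤ × ℤ) :
    laurentMonomial x y (n • k) = laurentMonomial x y k ^ n := by
  simp only [laurentMonomial, Prod.smul_fst, Prod.smul_snd, ← natCast_zsmul, smul_eq_mul, mul_pow,
    zpow_mul', zpow_natCast]

theorem eq_of_map_laurentMonomial_eq {H : Type*} [Group H] {φ ψ : G →* H} {u v : ℤ × ℤ}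
    (hdet : (u.1 * v.2 - u.2 * v.1).natAbs = 1)
    (hu : φ (laurentMonomial x y u) = ψ (laurentMonomial x y u))
    (hv : φ (laurentMonomial x y v) = ψ (laurentMonomial x y v)) : φ x = ψ x ∧ φ y = ψ y := by
  have hx : laurentMonomial x y u ^ v.2 * laurentMonomial x y v ^ (-u.2) =
      x ^ (u.1 * v.2 - u.2 * v.1) := by
    simp only [laurentMonomial, mul_zpow, ← zpow_mul]
    rw [mul_mul_mul_comm, ← zpow_add, ← zpow_add]
    ring_nf
    simp
  have hy : laurentMonomial x y u ^ (-v.1) * laurentMonomial x y v ^ u.1 =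
      y ^ (u.1 * v.2 - u.2 * v.1) := by
    simp only [laurentMonomial, mul_zpow, ← zpow_mul]
    rw [mul_mul_mul_comm, ← zpow_add, ← zpow_add]
    ring_nf
    simp
  have hxE : x ^ (u.1 * v.2 - u.2 * v.1) ∈ φ.eqLocus ψ :=
    hx ▸ mul_mem (zpow_mem hu _) (zpow_mem hv _)
  have hyE : y ^ (u.1 * v.2 - u.2 * v.1) ∈ φ.eqLocus ψ :=
    hy ▸ mul_mem (zpow_mem hu _) (zpow_mem hv _)
  rcases Int.natAbs_eq_iff.1 hdet with h | h <;> rw [h] at hxE hyE <;>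
    simp only [Nat.cast_one, zpow_one, zpow_neg, inv_mem_iff] at hxE hyE <;> exact ⟨hxE, hyE⟩

end

theorem span_laurentMonomial_jets_eq_top {K : Type*} [Field K]
    (x y : (Fin 3 → DualNumber K)ˣ)
    (hx : ∀ s t, s ≠ t → (x.1 s).fst ≠ (x.1 t).fst)
    (himm : ∀ s, (x.1 s).snd ≠ 0) {u v : ℤ × ℤ}
    (hdet : (u.1 * v.2 - u.2 * v.1).natAbs = 1) (t : ℤ × ℤ) {S : Set (ℤ × ℤ)}
    (hS : ∀ i ≤ 5, ∀ j ≤ 5, i • u + j • v + t ∈ S) :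
    Submodule.span K ((fun k => (laurentMonomial x y k).1) '' S) = ⊤ := by
  set g := laurentMonomial x y u with hg
  set h := laurentMonomial x y v with hh
  let τ := laurentMonomial x y t
  let ev (s : Fin 3) : (Fin 3 → DualNumber K)ˣ →* (DualNumber K)ˣ :=
    Units.map (Pi.evalMonoidHom _ s)
  let res : (DualNumber K)ˣ →* Kˣ := Units.map (fstHom K K K : DualNumber K →* K)
  let incl : Kˣ →* (DualNumber K)ˣ := Units.map (inlHom K K : K →* DualNumber K)
  have htop : bidegreeSpan K g.1 h.1 5 = ⊤ := by
    refine bidegreeSpan_jets_eq_top (fun s s' hs => ?_) (fun s => ?_)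
    · by_contra! H
      have hu : res.comp (ev s) g = res.comp (ev s') g := Units.ext H.1
      have hv : res.comp (ev s) h = res.comp (ev s') h := Units.ext H.2
      have := (eq_of_map_laurentMonomial_eq x y hdet hu hv).1
      exact hx s s' hs (congrArg Units.val this)
    · by_contra! H
      have := (eq_of_map_laurentMonomial_eq x y (φ := ev s)
        (ψ := incl.comp (res.comp (ev s))) hdet
        (Units.ext (TrivSqZeroExt.ext rfl H.1)) (Units.ext (TrivSqZeroExt.ext rfl H.2))).1
      exact himm s (congrArg (fun z => z.1.snd) this)
  rw [eq_top_iff]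
  intro z _
  have hz : τ⁻¹.1 * z ∈ bidegreeSpan K g.1 h.1 5 := htop ▸ Submodule.mem_top
  have := Submodule.mem_map_of_mem (f := LinearMap.mulLeft K τ.1) hz
  rw [LinearMap.mulLeft_apply, Units.mul_inv_cancel_left, bidegreeSpan, Submodule.map_span] at this
  refine Submodule.span_mono ?_ this
  rintro _ ⟨_, ⟨i, hi, j, hj, rfl⟩, rfl⟩
  refine ⟨_, hS i hi j hj, ?_⟩
  simp only [laurentMonomial_add, laurentMonomial_smul, LinearMap.mulLeft_apply]
  push_cast
  ring

section

variable {R : Type*} [CommRing R]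

/-- The first-order jet, along the direction `(1, m)` at `(x, y)`, of the monomial with
exponent `k`. -/
def jetMonomial (m x y : R) (k : ℕ × ℕ) : DualNumber R :=
  (inl x + inr 1) ^ k.1 * (inl y + inr m) ^ k.2

theorem map_fst_jetMonomial {S : Type*} [CommRing S] (φ : R →+* S) (m x y : R) (k : ℕ × ℕ) :
    φ (jetMonomial m x y k).fst = (jetMonomial (φ m) (φ x) (φ y) k).fst := by
  simp [jetMonomial]

theorem map_snd_jetMonomial {S : Type*} [CommRing S] (φ : R →+* S) (m x y : R) (k : ℕ × ℕ) :
    φ (jetMonomial m x y k).snd = (jetMonomial (φ m) (φ x) (φ y) k).snd := by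
  simp [jetMonomial, snd_pow]

end

/-- The matrix of the first-order jets of the monomials with exponents in `P` at three points
of the line `y = m * x + c`. The variables are `m`, `c` and the abscissae of the points. -/
def tangencyMatrix (P : Set (ℤ × ℤ)) :
    Matrix (Fin 3 ⊕ Fin 3) P (MvPolynomial (Fin 2 ⊕ Fin 3) ℂ) :=
  let jet (s : Fin 3) (k : P) : DualNumber (MvPolynomial (Fin 2 ⊕ Fin 3) ℂ) :=
    jetMonomial (X (Sum.inl 0)) (X (Sum.inr s)) (X (Sum.inl 0) * X (Sum.inr s) + X (Sum.inl 1))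
      (k.1.1.toNat, k.1.2.toNat)
  Matrix.of (Sum.elim (fun s k => (jet s k).fst) (fun s k => (jet s k).snd))

/-- The components of a triple of dual numbers. -/
def dualNumberComponents (K : Type*) [CommRing K] :
    (Fin 3 → DualNumber K) →ₗ[K] (Fin 3 ⊕ Fin 3 → K) where
  toFun x := Sum.elim (fun s => (x s).fst) (fun s => (x s).snd)
  map_add' x y := by ext (s | s) <;> simp
  map_smul' c x := by ext (s | s) <;> simp

theorem dualNumberComponents_surjective (K : Type*) [CommRing K] :
    Function.Surjective (dualNumberComponents K) := fun w =>
  ⟨fun s => inl (w (Sum.inl s)) + inr (w (Sum.inr s)), by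
    ext (s | s) <;> simp [dualNumberComponents]⟩

theorem tangencyMatrix_col (P : Set (ℤ × ℤ)) (z : Fin 2 ⊕ Fin 3 → ℂ) (k : P) :
    ((tangencyMatrix P).map (eval z)).col k = dualNumberComponents ℂ fun s =>
      jetMonomial (z (Sum.inl 0)) (z (Sum.inr s)) (z (Sum.inl 0) * z (Sum.inr s) + z (Sum.inl 1))
        (k.1.1.toNat, k.1.2.toNat) := by
  ext (s | s)
  · simp [tangencyMatrix, dualNumberComponents, map_fst_jetMonomial]
  · simp [tangencyMatrix, dualNumberComponents, map_snd_jetMonomial]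

theorem span_tangencyMatrix_col_eq_top {P : Set (ℤ × ℤ)} (hpos : ∀ k ∈ P, 0 ≤ k.1 ∧ 0 ≤ k.2)
    {u v : ℤ × ℤ} (hdet : (u.1 * v.2 - u.2 * v.1).natAbs = 1) (t : ℤ × ℤ)
    (hP : ∀ i ≤ 5, ∀ j ≤ 5, i • u + j • v + t ∈ P) (z : Fin 2 ⊕ Fin 3 → ℂ)
    (hx : ∀ s, z (Sum.inr s) ≠ 0)
    (hy : ∀ s, z (Sum.inl 0) * z (Sum.inr s) + z (Sum.inl 1) ≠ 0)
    (hinj : ∀ s s', s ≠ s' → z (Sum.inr s) ≠ z (Sum.inr s')) :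
    Submodule.span ℂ (Set.range ((tangencyMatrix P).map (eval z)).col) = ⊤ := by
  have hxu : IsUnit (fun s => inl (z (Sum.inr s)) + inr 1 : Fin 3 → DualNumber ℂ) :=
    Pi.isUnit_iff.2 fun s => isUnit_iff_isUnit_fst.2 (by simpa using hx s)
  have hyu : IsUnit (fun s => inl (z (Sum.inl 0) * z (Sum.inr s) + z (Sum.inl 1)) +
      inr (z (Sum.inl 0)) : Fin 3 → DualNumber ℂ) :=
    Pi.isUnit_iff.2 fun s => isUnit_iff_isUnit_fst.2 (by simpa using hy s)
  obtain ⟨x, hx'⟩ := hxu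
  obtain ⟨y, hy'⟩ := hyu
  have hspan := span_laurentMonomial_jets_eq_top (K := ℂ) x y (by simpa [hx'] using hinj)
    (by simp [hx']) hdet t hP
  have hmap := congrArg (Submodule.map (dualNumberComponents ℂ)) hspan
  rw [Submodule.map_span, Submodule.map_top,
    LinearMap.range_eq_top.2 (dualNumberComponents_surjective ℂ)] at hmap
  rw [eq_top_iff, ← hmap]
  refine Submodule.span_mono ?_
  rintro _ ⟨_, ⟨k, hk, rfl⟩, rfl⟩
  refine ⟨⟨k, hk⟩, ?_⟩
  rw [tangencyMatrix_col]
  congr 1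
  obtain ⟨h1, h2⟩ := hpos k hk
  obtain ⟨⟨i, hi⟩, ⟨j, hj⟩⟩ := And.intro (Int.eq_ofNat_of_zero_le h1) (Int.eq_ofNat_of_zero_le h2)
  funext s
  simp [laurentMonomial, hi, hj, jetMonomial, hx', hy']

theorem aeval_eq_zero_of_two_le_interMult {f : MvPolynomial (Fin 2) ℂ} {p w : ℂ × ℂ}
    (h : 2 ≤ interMult f p w) (c : ℂ) :
    aeval (fun i : Fin 2 => (if i = 0 then inl p.1 + inr (c * w.1)
      else inl p.2 + inr (c * w.2) : DualNumber ℂ)) f = 0 := by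
  have hdvd : Polynomial.X ^ 2 ∣ lineRestrict f p w := by
    unfold interMult at h
    split_ifs at h with h0
    · simp [h0]
    · have := (Polynomial.le_rootMultiplicity_iff h0).1 (Nat.cast_le.1 h)
      simpa using this
  obtain ⟨q, hq⟩ := hdvd
  have hsq : Polynomial.aeval (inr c : DualNumber ℂ) (lineRestrict f p w) = 0 := by
    rw [hq, map_mul, map_pow, Polynomial.aeval_X, pow_two, inr_mul_inr, zero_mul]
  rw [← hsq, lineRestrict, MvPolynomial.comp_aeval_apply]
  congr 2
  funext i
  split_ifs <;>
  · simp only [map_add, map_mul, Polynomial.aeval_C, Polynomial.aeval_X, algebraMap_eq_inl,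
      inl_mul_inr, smul_eq_mul, mul_comm c]

theorem eq_sum_coeffAt {f : MvPolynomial (Fin 2) ℂ} {P : Set (ℤ × ℤ)} [Fintype P]
    (hpos : ∀ k ∈ P, 0 ≤ k.1 ∧ 0 ≤ k.2) (hf : SuppIn f P) :
    f = ∑ k : P, coeffAt f k.1 • (X 0 ^ k.1.1.toNat * X 1 ^ k.1.2.toNat) := by
  have hmon (i j : ℕ) : (X 0 ^ i * X 1 ^ j : MvPolynomial (Fin 2) ℂ) =
      monomial (Finsupp.single 0 i + Finsupp.single 1 j) 1 := by
    simp [X_pow_eq_monomial, monomial_mul]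
  ext n
  have hn : n = Finsupp.single 0 (n 0) + Finsupp.single 1 (n 1) := by
    ext i; fin_cases i <;> simp
  simp only [hmon, coeff_sum, coeff_smul, coeff_monomial, smul_eq_mul, mul_ite, mul_one, mul_zero]
  have hexp (k : P) : Finsupp.single 0 k.1.1.toNat + Finsupp.single 1 k.1.2.toNat = n ↔
      k.1 = ((n 0 : ℤ), (n 1 : ℤ)) := by
    obtain ⟨h1, h2⟩ := hpos k k.2
    constructor
    · rintro rfl
      ext <;> simp [h1, h2]
    · intro h
      rw [hn, h]
      simp
  simp only [hexp]
  by_cases hmem : ((n 0 : ℤ), (n 1 : ℤ)) ∈ P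
  · rw [Finset.sum_eq_single_of_mem ⟨_, hmem⟩ (Finset.mem_univ _)]
    · simp [coeffAt, ← hn]
    · rintro k - hk
      rw [if_neg fun h => hk (Subtype.ext h)]
  · rw [Finset.sum_eq_zero, ← notMem_support_iff]
    · exact fun h => hmem (hf n h)
    · rintro k -
      rw [if_neg]
      intro h
      exact hmem (h ▸ k.2)

theorem smul_add_smul_mem_five_smul_parallelogram (u v : ℤ × ℤ) {i j : ℕ} (hi : i ≤ 5)
    (hj : j ≤ 5) : rpt (i • u + j • v) ∈
      (5 : ℝ) • convexHull ℝ {(0, 0), rpt u, rpt v, rpt (u + v)} := by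
  set S : Set (ℝ × ℝ) := {(0, 0), rpt u, rpt v, rpt (u + v)}
  have hS := subset_convexHull ℝ S
  have hi' : (i : ℝ) ≤ 5 := by exact_mod_cast hi
  have hj' : (j : ℝ) ≤ 5 := by exact_mod_cast hj
  have hcomb {p q : ℝ × ℝ} (hp : p ∈ convexHull ℝ S) (hq : q ∈ convexHull ℝ S) {n : ℕ}
      (hn : (n : ℝ) ≤ 5) : (1 - n / 5 : ℝ) • p + (n / 5 : ℝ) • q ∈ convexHull ℝ S :=
    convex_convexHull ℝ S hp hq (by linarith) (by positivity) (by ring)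
  refine ⟨_, hcomb (hcomb (hS (by simp [S]) : ((0, 0) : ℝ × ℝ) ∈ _)
    (hS (by simp [S]) : rpt v ∈ _) hj') (hcomb (hS (by simp [S]) : rpt u ∈ _)
    (hS (by simp [S]) : rpt (u + v) ∈ _) hj') hi', ?_⟩
  ext <;> simp [rpt] <;> ring

theorem no_tritangents (u v : ℤ × ℤ) (hdet : (u.1 * v.2 - u.2 * v.1).natAbs = 1)
    (R : Set (ℝ × ℝ)) (hR : R = convexHull ℝ {(0, 0), rpt u, rpt v, rpt (u + v)})
    (P : Set (ℤ × ℤ)) (hfin : P.Finite) (hpos : ∀ k ∈ P, 0 ≤ k.1 ∧ 0 ≤ k.2)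
    (h5 : ∃ t : ℤ × ℤ, ∀ k : ℤ × ℤ, rpt k ∈ (5 : ℝ) • R → k + t ∈ P) :
    GenericOn P (fun f =>
      ¬∃ (a b : ℂ) (p₁ p₂ p₃ : ℂ × ℂ), a ≠ 0 ∧ b ≠ 0 ∧
        p₁ ≠ p₂ ∧ p₁ ≠ p₃ ∧ p₂ ≠ p₃ ∧
        p₁ ∈ Torus ∧ p₂ ∈ Torus ∧ p₃ ∈ Torus ∧
        a * p₁.1 + b * p₁.2 + 1 = 0 ∧ a * p₂.1 + b * p₂.2 + 1 = 0 ∧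
        a * p₃.1 + b * p₃.2 + 1 = 0 ∧
        2 ≤ interMult f p₁ (b, -a) ∧ 2 ≤ interMult f p₂ (b, -a) ∧
        2 ≤ interMult f p₃ (b, -a)) := by
  subst hR
  have := hfin.fintype
  obtain ⟨t, ht⟩ := h5
  obtain ⟨D, hD0, hD⟩ := exists_polynomial_vanishing_on_kernels (by simp) (tangencyMatrix P)
  refine ⟨D, hD0, fun f hf hDf => ?_⟩
  rintro ⟨a, b, p₁, p₂, p₃, ha, hb, h₁₂, h₁₃, h₂₃, hT₁, hT₂, hT₃, hL₁, hL₂, hL₃, hM₁, hM₂, hM₃⟩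
  let p : Fin 3 → ℂ × ℂ := ![p₁, p₂, p₃]
  have hp : Function.Injective p := by
    intro s s' h
    fin_cases s <;> fin_cases s' <;> first
      | rfl
      | exact absurd h h₁₂
      | exact absurd h h₁₃
      | exact absurd h h₂₃
      | exact absurd h.symm h₁₂
      | exact absurd h.symm h₁₃
      | exact absurd h.symm h₂₃
  have hT (s) : p s ∈ Torus := by
    fin_cases s
    exacts [hT₁, hT₂, hT₃]
  have hL (s) : a * (p s).1 + b * (p s).2 + 1 = 0 := by
    fin_cases s
    exacts [hL₁, hL₂, hL₃]
  have hM (s) : 2 ≤ interMult f (p s) (b, -a) := by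
    fin_cases s
    exacts [hM₁, hM₂, hM₃]
  let z : Fin 2 ⊕ Fin 3 → ℂ := Sum.elim ![-a / b, -1 / b] fun s => (p s).1
  have hz (s) : z (Sum.inl 0) * z (Sum.inr s) + z (Sum.inl 1) = (p s).2 := by
    simp only [z, Sum.elim_inl, Sum.elim_inr, Matrix.cons_val_zero, Matrix.cons_val_one]
    field_simp
    linear_combination -hL s
  refine hDf (hD z _ (span_tangencyMatrix_col_eq_top hpos hdet t
    (fun i hi j hj => ht _ (smul_add_smul_mem_five_smul_parallelogram u v hi hj)) z
    (fun s => (hT s).1) (fun s => hz s ▸ (hT s).2) fun s s' hs h => hs (hp ?_)) ?_)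
  · exact Prod.ext h (by rw [← hz s, ← hz s', h])
  · have hjet (s : Fin 3) : ∑ k : P, coeffAt f k.1 •
        jetMonomial (z (Sum.inl 0)) (z (Sum.inr s)) (p s).2 (k.1.1.toNat, k.1.2.toNat) = 0 := by
      have h := aeval_eq_zero_of_two_le_interMult (hM s) b⁻¹
      rw [eq_sum_coeffAt hpos hf] at h
      simp only [map_sum, map_smul, map_mul, map_pow, aeval_X] at h
      simpa [z, jetMonomial, hb, div_eq_inv_mul] using h
    have hsum : (tangencyMatrix P).map (eval z) *ᵥ (fun k => coeffAt f k.1) =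
        ∑ k : P, coeffAt f k.1 • ((tangencyMatrix P).map (eval z)).col k := by
      ext i
      simp [Matrix.mulVec, dotProduct, mul_comm]
    rw [hsum]
    simp only [tangencyMatrix_col, ← map_smul, ← map_sum]
    rw [← map_zero (dualNumberComponents ℂ)]
    congr 1
    funext s
    simpa [hz] using hjet s

end
end

section
/- Let P ⊂ ℤ² ∩ [0,∞)² be a finite set such that for some integer a ≥ 0 there exist points of P with second coordinates a, a+1, a+2 and a+3. Then for a generic polynomial f ∈ ℂ^P, the curve {f=0} has no vertical bitangent: there exist no X₀ ∈ ℂ∖{0} and distinct Y₁, Y₂ ∈ ℂ∖{0} such that f(X₀,Y₁) = (∂f/∂y)(X₀,Y₁) = 0 and f(X₀,Y₂) = (∂f/∂y)(X₀,Y₂) = 0. -/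
open scoped Pointwise
open MvPolynomial

noncomputable section

/-- The values at `(X, Y)` and `(X, Z)` of the monomial `x ^ i * y ^ b` and of its image
under `y ∂/∂y`. -/
def hermiteVec {A : Type*} [CommRing A] (X Y Z : A) (i b : ℕ) : Fin 4 → A :=
  ![X ^ i * Y ^ b, b * (X ^ i * Y ^ b), X ^ i * Z ^ b, b * (X ^ i * Z ^ b)]

lemma map_hermiteVec {A B : Type*} [CommRing A] [CommRing B] (φ : A →+* B) (X Y Z : A)
    (i b : ℕ) (r : Fin 4) :
    φ (hermiteVec X Y Z i b r) = hermiteVec (φ X) (φ Y) (φ Z) i b r := by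
  fin_cases r <;> simp [hermiteVec]

/-- The matrix whose columns are the vectors `hermiteVec` of four monomials. -/
def hermiteMatrix {A : Type*} [CommRing A] (X Y Z : A) (s t : Fin 4 → ℕ) :
    Matrix (Fin 4) (Fin 4) A :=
  Matrix.of fun r j => hermiteVec X Y Z (s j) (t j) r

lemma det_hermiteMatrix {A : Type*} [CommRing A] (X Y Z : A) (s : Fin 4 → ℕ) (a : ℕ) :
    (hermiteMatrix X Y Z s (fun j => a + j)).det =
      X ^ (s 0 + s 1 + s 2 + s 3) * (Y * Z) ^ (2 * a + 1) * (Y - Z) ^ 4 := by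
  simp [hermiteMatrix, hermiteVec, Matrix.det_succ_row_zero, Fin.sum_univ_succ, Fin.succAbove]
  ring

lemma map_hermiteMatrix {A B : Type*} [CommRing A] [CommRing B] (φ : A →+* B) (X Y Z : A)
    (s t : Fin 4 → ℕ) :
    φ.mapMatrix (hermiteMatrix X Y Z s t) = hermiteMatrix (φ X) (φ Y) (φ Z) s t := by
  ext r j
  simp [hermiteMatrix, map_hermiteVec]

section HermiteSolution

variable {I : Type*} [Fintype I] [DecidableEq I] (p q : I → ℕ) (κ : Fin 4 → I)

/-- A solution, by Cramer's rule, of the linear system `∑ i, c i • hermiteVec X Y Z (p i) (q i) = 0`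
whose coordinates outside the range of `κ` are proportional to those of `e`. -/
def hermiteSolution {A : Type*} [CommRing A] (X Y Z : A) (e : I → A) (i : I) : A :=
  (hermiteMatrix X Y Z (p ∘ κ) (q ∘ κ)).det * e i +
    ∑ j, if κ j = i then
      ((hermiteMatrix X Y Z (p ∘ κ) (q ∘ κ)).adjugate.mulVec
        (fun r => -∑ k, e k * hermiteVec X Y Z (p k) (q k) r)) j else 0

lemma map_hermiteSolution {A B : Type*} [CommRing A] [CommRing B] (φ : A →+* B) (X Y Z : A)
    (e : I → A) (i : I) :
    φ (hermiteSolution p q κ X Y Z e i) =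
      hermiteSolution p q κ (φ X) (φ Y) (φ Z) (fun k => φ (e k)) i := by
  have hadj : (hermiteMatrix X Y Z (p ∘ κ) (q ∘ κ)).adjugate.map φ =
      (hermiteMatrix (φ X) (φ Y) (φ Z) (p ∘ κ) (q ∘ κ)).adjugate := by
    rw [← map_hermiteMatrix, ← RingHom.map_adjugate, RingHom.mapMatrix_apply]
  simp only [hermiteSolution, map_add, map_mul, map_sum, RingHom.map_det, map_hermiteMatrix,
    apply_ite φ, map_zero, RingHom.map_mulVec, hadj]
  simp [Function.comp_def, map_hermiteVec]

lemma hermiteSolution_eq {K : Type*} [Field K] (hκ : Function.Injective κ) (X Y Z : K)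
    (hdet : (hermiteMatrix X Y Z (p ∘ κ) (q ∘ κ)).det ≠ 0) (c : I → K)
    (hc : ∀ r, ∑ i, c i * hermiteVec X Y Z (p i) (q i) r = 0) :
    hermiteSolution p q κ X Y Z
      (fun i => if i ∈ Set.range κ then 0
        else c i / (hermiteMatrix X Y Z (p ∘ κ) (q ∘ κ)).det) = c := by
  classical
  set M := hermiteMatrix X Y Z (p ∘ κ) (q ∘ κ) with hM
  have key : (fun r => -∑ k, (if k ∈ Set.range κ then 0 else c k / M.det) *
      hermiteVec X Y Z (p k) (q k) r) = M.mulVec (fun j => c (κ j) / M.det) := by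
    ext r
    have h1 : ∑ k, c k * hermiteVec X Y Z (p k) (q k) r =
        ∑ k, (if k ∈ Set.range κ then 0 else c k) * hermiteVec X Y Z (p k) (q k) r +
        ∑ j, c (κ j) * hermiteVec X Y Z (p (κ j)) (q (κ j)) r := by
      have h2 : ∑ j, c (κ j) * hermiteVec X Y Z (p (κ j)) (q (κ j)) r =
          ∑ k, (if k ∈ Set.range κ then c k else 0) * hermiteVec X Y Z (p k) (q k) r := by
        refine (Finset.sum_image (s := Finset.univ) (g := κ)
          (f := fun k => c k * hermiteVec X Y Z (p k) (q k) r) hκ.injOn).symm.trans ?_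
        simp only [ite_mul, zero_mul]
        rw [← Finset.sum_filter]
        congr 1
        ext k
        simp
      rw [h2, ← Finset.sum_add_distrib]
      refine Finset.sum_congr rfl fun k _ => ?_
      split_ifs <;> ring
    rw [hc r] at h1
    have h3 : ∑ k, (if k ∈ Set.range κ then 0 else c k / M.det) *
        hermiteVec X Y Z (p k) (q k) r =
        (∑ k, (if k ∈ Set.range κ then 0 else c k) * hermiteVec X Y Z (p k) (q k) r) / M.det := by
      rw [Finset.sum_div]
      refine Finset.sum_congr rfl fun k _ => ?_
      split_ifs <;> ring
    have h4 : M.mulVec (fun j => c (κ j) / M.det) r =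
        (∑ j, c (κ j) * hermiteVec X Y Z (p (κ j)) (q (κ j)) r) / M.det := by
      rw [Finset.sum_div, Matrix.mulVec, dotProduct]
      refine Finset.sum_congr rfl fun k _ => ?_
      simp only [hM, hermiteMatrix, Matrix.of_apply, Function.comp_apply]
      ring
    rw [h3, h4, ← neg_div]
    congr 1
    linear_combination h1
  ext i
  unfold hermiteSolution
  rw [← hM, key, Matrix.mulVec_mulVec, Matrix.adjugate_mul, Matrix.smul_mulVec,
    Matrix.one_mulVec]
  by_cases hi : i ∈ Set.range κ
  · obtain ⟨j, rfl⟩ := hi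
    simp only [hκ.eq_iff]
    simp [mul_div_cancel₀, hdet]
  · have : ∀ j, κ j ≠ i := fun j h => hi ⟨j, h⟩
    simp [this, mul_div_cancel₀, hdet]

end HermiteSolution

/-- The image of a polynomial map from an affine space to one of larger dimension lies in a
hypersurface. -/
lemma exists_ne_zero_eval_eq_zero {K : Type*} {σ I : Type} [Field K] [Fintype σ] [Fintype I]
    (h : Fintype.card σ < Fintype.card I) (Φ : I → MvPolynomial σ K) :
    ∃ D : MvPolynomial I K, D ≠ 0 ∧ ∀ x : σ → K, eval (fun i => eval x (Φ i)) D = 0 := by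
  have hdep : ¬ AlgebraicIndependent K Φ := by
    intro hΦ
    have := hΦ.lift_cardinalMk_le_trdeg
    rw [MvPolynomial.trdeg_of_isDomain] at this
    simp only [Cardinal.mk_fintype, Cardinal.lift_natCast, Nat.cast_le] at this
    omega
  rw [algebraicIndependent_iff] at hdep
  push Not at hdep
  obtain ⟨D, hD, hD0⟩ := hdep
  refine ⟨D, hD0, fun x => ?_⟩
  have := congrArg (eval x) hD
  rw [map_zero, aeval_def, ← coe_eval₂Hom, ← RingHom.comp_apply] at this
  rw [← this]
  refine DFunLike.congr_fun (MvPolynomial.ringHom_ext (fun r => ?_) (fun i => ?_)) D <;>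
    simp [MvPolynomial.algebraMap_eq]

lemma exists_hypersurface_of_hermite {I : Type} [Fintype I] (p q : I → ℕ) (κ : Fin 4 → I) (a : ℕ)
    (hq : ∀ j, q (κ j) = a + j) :
    ∃ D : MvPolynomial I ℂ, D ≠ 0 ∧ ∀ (c : I → ℂ) (X Y Z : ℂ), X ≠ 0 → Y ≠ 0 → Z ≠ 0 → Y ≠ Z →
      (∀ r, ∑ i, c i * hermiteVec X Y Z (p i) (q i) r = 0) → eval c D = 0 := by
  classical
  have hκ : Function.Injective κ := fun j k h => by
    have h1 := hq j
    rw [h, hq k] at h1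
    exact Fin.ext (by omega)
  have hcard : Fintype.card (Fin 3 ⊕ {i // i ∉ Set.range κ}) < Fintype.card I := by
    have h1 := Fintype.card_subtype_compl (fun i => i ∈ Set.range κ)
    have h2 : Fintype.card {i // i ∈ Set.range κ} = 4 := by
      exact (Set.card_range_of_injective hκ).trans (Fintype.card_fin 4)
    have h3 := Fintype.card_subtype_le (fun i => i ∈ Set.range κ)
    rw [Fintype.card_sum, h1, Fintype.card_fin]
    omega
  obtain ⟨D, hD, hD0⟩ := exists_ne_zero_eval_eq_zero (K := ℂ) hcard
    (hermiteSolution p q κ (X (.inl 0)) (X (.inl 1)) (X (.inl 2))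
      (fun i => if h : i ∈ Set.range κ then 0 else X (.inr ⟨i, h⟩)))
  refine ⟨D, hD, fun c x y z hx hy hz hyz hc => ?_⟩
  have hdet : (hermiteMatrix x y z (p ∘ κ) (q ∘ κ)).det ≠ 0 := by
    have h1 : q ∘ κ = fun j : Fin 4 => a + (j : ℕ) := funext hq
    rw [h1, det_hermiteMatrix]
    simp [hx, hy, hz, sub_ne_zero.2 hyz]
  have := hD0 (Sum.elim ![x, y, z]
    fun i => c i / (hermiteMatrix x y z (p ∘ κ) (q ∘ κ)).det)
  rw [← this]
  congr 2
  ext i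
  rw [map_hermiteSolution]
  refine (congrFun (hermiteSolution_eq p q κ hκ x y z hdet c hc) i).symm.trans ?_
  simp [apply_dite, dite_eq_ite]

/-- The exponent vector of a lattice point with nonnegative coordinates. -/
def expOf (k : ℤ × ℤ) : Fin 2 →₀ ℕ :=
  Finsupp.single (0 : Fin 2) k.1.toNat + Finsupp.single (1 : Fin 2) k.2.toNat

lemma eq_sum_monomial_of_suppIn {P : Set (ℤ × ℤ)} [Fintype P] (hpos : ∀ k ∈ P, 0 ≤ k.1 ∧ 0 ≤ k.2)
    {f : MvPolynomial (Fin 2) ℂ} (hf : SuppIn f P) :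
    f = ∑ k : P, monomial (expOf k) (coeffAt f k) := by
  classical
  ext m
  simp only [coeff_sum, coeff_monomial]
  have hinj : ∀ k : P, expOf k = m ↔ (k : ℤ × ℤ) = ((m 0 : ℤ), (m 1 : ℤ)) := by
    intro k
    obtain ⟨h1, h2⟩ := hpos k k.2
    rw [Finsupp.ext_iff, Fin.forall_fin_two, Prod.ext_iff]
    simp only [expOf, Finsupp.add_apply, Finsupp.single_apply]
    simp
    omega
  by_cases hm : m ∈ f.support
  · rw [Finset.sum_eq_single ⟨_, hf m hm⟩]
    · rw [if_pos ((hinj _).2 rfl)]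
      have := (hinj ⟨_, hf m hm⟩).2 rfl
      simp only [expOf] at this
      simp [coeffAt] at this ⊢
      rw [this]
    · intro k _ hk
      rw [if_neg fun h => hk (Subtype.ext ((hinj k).1 h))]
    · simp
  · rw [notMem_support_iff.1 hm, Finset.sum_eq_zero]
    intro k _
    split_ifs with h
    · obtain ⟨h1, h2⟩ := hpos k k.2
      simp only [coeffAt, h1, h2, and_self, if_true]
      change coeff (expOf k) f = 0
      rw [h, notMem_support_iff.1 hm]
    · rfl

lemma evalP_monomial_expOf (k : ℤ × ℤ) (c x y : ℂ) :
    evalP (monomial (expOf k) c) (x, y) = c * (x ^ k.1.toNat * y ^ k.2.toNat) := by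
  simp [evalP, expOf, eval_monomial, Finsupp.prod_fintype]

lemma mul_evalP_pderiv_monomial_expOf (k : ℤ × ℤ) (c x y : ℂ) :
    y * evalP (pderiv 1 (monomial (expOf k) c)) (x, y) =
      c * (k.2.toNat * (x ^ k.1.toNat * y ^ k.2.toNat)) := by
  have h : y * evalP (pderiv 1 (monomial (expOf k) c)) (x, y) =
      evalP (X 1 * pderiv 1 (monomial (expOf k) c)) (x, y) := by
    simp [evalP]
  rw [h, X_mul_pderiv_monomial]
  have h2 : ∀ (n : ℕ) (g : MvPolynomial (Fin 2) ℂ), evalP (n • g) (x, y) = n * evalP g (x, y) := by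
    simp [evalP]
  rw [h2, evalP_monomial_expOf]
  simp [expOf]
  ring

theorem no_vertical_bitangents (P : Set (ℤ × ℤ)) (hfin : P.Finite)
    (hpos : ∀ k ∈ P, 0 ≤ k.1 ∧ 0 ≤ k.2) (a : ℤ) (ha : 0 ≤ a)
    (h0 : ∃ k ∈ P, k.2 = a) (h1 : ∃ k ∈ P, k.2 = a + 1)
    (h2 : ∃ k ∈ P, k.2 = a + 2) (h3 : ∃ k ∈ P, k.2 = a + 3) :
    GenericOn P (fun f =>
      ¬∃ X₀ Y₁ Y₂ : ℂ, X₀ ≠ 0 ∧ Y₁ ≠ 0 ∧ Y₂ ≠ 0 ∧ Y₁ ≠ Y₂ ∧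
        evalP f (X₀, Y₁) = 0 ∧ evalP (pderiv 1 f) (X₀, Y₁) = 0 ∧
        evalP f (X₀, Y₂) = 0 ∧ evalP (pderiv 1 f) (X₀, Y₂) = 0) := by
  have := hfin.fintype
  obtain ⟨k0, hk0, e0⟩ := h0
  obtain ⟨k1, hk1, e1⟩ := h1
  obtain ⟨k2, hk2, e2⟩ := h2
  obtain ⟨k3, hk3, e3⟩ := h3
  obtain ⟨D, hD, hD0⟩ := exists_hypersurface_of_hermite (I := P) (fun k => k.1.1.toNat)
    (fun k => k.1.2.toNat) ![⟨k0, hk0⟩, ⟨k1, hk1⟩, ⟨k2, hk2⟩, ⟨k3, hk3⟩] a.toNat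
    (fun j => by fin_cases j <;> simp <;> omega)
  refine ⟨D, hD, fun f hf hne => ?_⟩
  rintro ⟨x, y, z, hx, hy, hz, hyz, hfy, hfy', hfz, hfz'⟩
  refine hne (hD0 _ x y z hx hy hz hyz ?_)
  have hval : ∀ w, evalP f (x, w) = 0 →
      ∑ k : P, coeffAt f k * (x ^ k.1.1.toNat * w ^ k.1.2.toNat) = 0 := fun w hw => by
    rw [← hw]
    conv_rhs => rw [eq_sum_monomial_of_suppIn hpos hf]
    simp_rw [← evalP_monomial_expOf]
    simp [evalP]
  have hder : ∀ w, evalP (pderiv 1 f) (x, w) = 0 →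
      ∑ k : P, coeffAt f k * (k.1.2.toNat * (x ^ k.1.1.toNat * w ^ k.1.2.toNat)) = 0 :=
    fun w hw => by
    rw [← mul_zero w, ← hw]
    conv_rhs => rw [eq_sum_monomial_of_suppIn hpos hf]
    simp_rw [← mul_evalP_pderiv_monomial_expOf]
    simp [evalP, Finset.mul_sum]
  intro r
  fin_cases r
  · exact hval y hfy
  · exact hder y hfy'
  · exact hval z hfz
  · exact hder z hfz'

end
end

section
/- Let P ⊂ ℤ² ∩ [0,∞)² be a finite set whose image under the projection (x,y) ↦ y contains at least three distinct values. Then for a generic polynomial f ∈ ℂ^P, the curve {f=0} has no inflection point with vertical tangent: there exists no point (X₀,Y₀) ∈ T such that f(X₀,Y₀) = 0, (∂f/∂y)(X₀,Y₀) = 0 and (∂²f/∂y²)(X₀,Y₀) = 0 (i.e., no vertical line meets {f=0} with intersection multiplicity ≥ 3 at a point of T). -/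
open scoped Pointwise
open MvPolynomial

noncomputable section

/-- Fewer variables than polynomials forces an algebraic relation. -/
theorem exists_ne_zero_aeval_eq_zero {ι σ : Type} [Fintype ι] [Fintype σ]
    (h : ι → MvPolynomial σ ℂ) (hcard : Fintype.card σ < Fintype.card ι) :
    ∃ D : MvPolynomial ι ℂ, D ≠ 0 ∧ aeval h D = 0 := by
  by_contra! H
  have hind : AlgebraicIndependent ℂ h :=
    algebraicIndependent_iff.2 fun D hD => by_contra fun h0 => H D h0 hD
  have hle := hind.cardinalMk_le_trdeg
  rw [MvPolynomial.trdeg_of_isDomain, Cardinal.lift_id, Cardinal.mk_fintype,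
    Cardinal.mk_fintype, Nat.cast_le] at hle
  omega

/-- If the moments of order less than `T.card` of `c` vanish and the nodes in `T` are distinct,
then `c` is determined linearly by its values outside `T`. -/
theorem exists_weights {ι : Type} [Fintype ι] [DecidableEq ι] (v : ι → ℂ) (T : Finset ι)
    (hv : Set.InjOn v T) :
    ∃ w : ι → {k // k ∉ T} → ℂ, ∀ c : ι → ℂ,
      (∀ r < T.card, ∑ k, v k ^ r * c k = 0) → ∀ t, c t = ∑ k, w t k * c k := by
  refine ⟨fun t k => if t ∈ T then -(Lagrange.basis T v t).eval (v k)
    else if t = k then 1 else 0, fun c hc t => ?_⟩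
  by_cases ht : t ∈ T
  · simp only [ht, if_true]
    have hdeg : (Lagrange.basis T v t).natDegree < T.card := by
      have hpos : 0 < T.card := Finset.card_pos.2 ⟨t, ht⟩
      rw [Polynomial.natDegree_eq_of_degree_eq_some (Lagrange.degree_basis hv ht)]
      omega
    have hall : ∑ k, (Lagrange.basis T v t).eval (v k) * c k = 0 := by
      simp only [Polynomial.eval_eq_sum_range' hdeg, Finset.sum_mul]
      rw [Finset.sum_comm]
      refine Finset.sum_eq_zero fun r hr => ?_
      simp only [mul_assoc]
      rw [← Finset.mul_sum, hc r (Finset.mem_range.1 hr), mul_zero]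
    rw [← Fintype.sum_subtype_add_sum_subtype (fun k => k ∈ T),
      Finset.sum_eq_single (⟨t, ht⟩ : {k // k ∈ T})] at hall
    · rw [Lagrange.eval_basis_self hv ht, one_mul] at hall
      simp only [neg_mul, Finset.sum_neg_distrib]
      linear_combination hall
    · rintro ⟨k, hk⟩ - hkt
      rw [Lagrange.eval_basis_of_ne (fun h => hkt (Subtype.ext h.symm)) hk, zero_mul]
    · simp
  · simp only [ht, if_false]
    rw [Finset.sum_eq_single (⟨t, ht⟩ : {k // k ∉ T})]
    · simp
    · rintro ⟨k, hk⟩ - hkt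
      have : t ≠ k := fun h => hkt (Subtype.ext h.symm)
      simp [this]
    · simp

theorem SuppIn.eq_sum_monomial {P : Set (ℤ × ℤ)} [Fintype P]
    (hpos : ∀ k ∈ P, 0 ≤ k.1 ∧ 0 ≤ k.2) {f : MvPolynomial (Fin 2) ℂ} (hf : SuppIn f P) :
    f = ∑ k : P, monomial
      (Finsupp.single (0 : Fin 2) k.1.1.toNat + Finsupp.single (1 : Fin 2) k.1.2.toNat)
      (coeffAt f k.1) := by
  classical
  ext m
  have hm : Finsupp.single (0 : Fin 2) (m 0) + Finsupp.single (1 : Fin 2) (m 1) = m := by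
    ext i
    fin_cases i <;> simp
  rw [coeff_sum]
  simp only [coeff_monomial]
  have key : ∀ k : P,
      Finsupp.single (0 : Fin 2) k.1.1.toNat + Finsupp.single (1 : Fin 2) k.1.2.toNat = m →
      k.1 = ((m 0 : ℤ), (m 1 : ℤ)) := by
    rintro ⟨k, hk⟩ rfl
    obtain ⟨h1, h2⟩ := hpos k hk
    ext <;> simp [h1, h2]
  by_cases hmP : ((m 0 : ℤ), (m 1 : ℤ)) ∈ P
  · rw [Finset.sum_eq_single ⟨_, hmP⟩]
    · simp [coeffAt, hm]
    · intro k _ hk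
      rw [if_neg fun h => hk (Subtype.ext (key k h))]
    · simp
  · rw [Finset.sum_eq_zero, ← notMem_support_iff]
    · exact fun h => hmP (hf m h)
    · intro k _
      rw [if_neg fun h => hmP (key k h ▸ k.2)]

/-- The value of a bivariate monomial together with its first two vertical derivatives. -/
theorem evalP_monomial (i j : ℕ) (a : ℂ) (p : ℂ × ℂ) :
    let M := monomial (Finsupp.single (0 : Fin 2) i + Finsupp.single (1 : Fin 2) j) a
    evalP M p = a * p.1 ^ i * p.2 ^ j ∧
    p.2 * evalP (pderiv 1 M) p = j * (a * p.1 ^ i * p.2 ^ j) ∧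
    p.2 ^ 2 * evalP (pderiv 1 (pderiv 1 M)) p = (j ^ 2 - j) * (a * p.1 ^ i * p.2 ^ j) := by
  have hM : monomial (Finsupp.single (0 : Fin 2) i + Finsupp.single (1 : Fin 2) j) a =
      C a * X 0 ^ i * X 1 ^ j := by
    rw [C_mul_X_pow_eq_monomial, X_pow_eq_monomial, monomial_mul, mul_one]
  rw [hM]
  simp only [evalP, Derivation.leibniz, Derivation.leibniz_pow, pderiv_X_self, pderiv_C,
    pderiv_X_of_ne (show (0 : Fin 2) ≠ 1 by decide)]
  refine ⟨by simp, ?_, ?_⟩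
  · rcases j with _ | j
    · simp
    · simp
      ring
  · rcases j with _ | _ | j
    · simp
    · simp
    · simp
      ring

theorem no_vertical_inflection_tangents (P : Set (ℤ × ℤ)) (hfin : P.Finite)
    (hpos : ∀ k ∈ P, 0 ≤ k.1 ∧ 0 ≤ k.2)
    (h3 : ∃ k₁ ∈ P, ∃ k₂ ∈ P, ∃ k₃ ∈ P,
      k₁.2 ≠ k₂.2 ∧ k₁.2 ≠ k₃.2 ∧ k₂.2 ≠ k₃.2) :
    GenericOn P (fun f =>
      ¬∃ p : ℂ × ℂ, p ∈ Torus ∧ evalP f p = 0 ∧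
        evalP (pderiv 1 f) p = 0 ∧ evalP (pderiv 1 (pderiv 1 f)) p = 0) := by
  classical
  have := hfin.fintype
  obtain ⟨k₁, hk₁, k₂, hk₂, k₃, hk₃, h12, h13, h23⟩ := h3
  let T : Finset P := {⟨k₁, hk₁⟩, ⟨k₂, hk₂⟩, ⟨k₃, hk₃⟩}
  have hT : T.card = 3 := Finset.card_eq_three.2 ⟨_, _, _,
    fun h => h12 (congrArg (fun k : P => k.1.2) h),
    fun h => h13 (congrArg (fun k : P => k.1.2) h),
    fun h => h23 (congrArg (fun k : P => k.1.2) h), rfl⟩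
  let v : P → ℂ := fun k => (k.1.2.toNat : ℂ)
  have hv : Set.InjOn v T := by
    have hinj : ∀ k l : P, v k = v l → k.1.2 = l.1.2 := by
      intro k l h
      have h' : k.1.2.toNat = l.1.2.toNat := Nat.cast_injective h
      have := (hpos k k.2).2
      have := (hpos l l.2).2
      omega
    intro k hk l hl h
    have := hinj k l h
    simp only [T, Finset.coe_insert, Finset.coe_singleton, Set.mem_insert_iff,
      Set.mem_singleton_iff] at hk hl
    rcases hk with rfl | rfl | rfl <;> rcases hl with rfl | rfl | rfl <;> simp_all
  obtain ⟨w, hw⟩ := exists_weights v T hv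
  let h : P → MvPolynomial ({k // k ∉ T} ⊕ Fin 2) ℂ := fun t =>
    (∑ k, C (w t k) * X (Sum.inl k)) * X (Sum.inr 0) ^ t.1.1.toNat * X (Sum.inr 1) ^ t.1.2.toNat
  obtain ⟨D, hD0, hD⟩ := exists_ne_zero_aeval_eq_zero h (by
    have hle := Finset.card_le_univ T
    rw [Fintype.card_sum, Fintype.card_fin, Fintype.card_subtype_compl, Fintype.card_coe]
    omega)
  refine ⟨D, hD0, fun f hf hDf => ?_⟩
  rintro ⟨⟨x, y⟩, ⟨hx : x ≠ 0, hy : y ≠ 0⟩, he0, he1, he2⟩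
  apply hDf
  let c : P → ℂ := fun k => coeffAt f k.1 * x ^ k.1.1.toNat * y ^ k.1.2.toNat
  have hsum := hf.eq_sum_monomial hpos
  have hm0 : ∑ k, c k = 0 := by
    rw [← he0]
    conv_rhs => rw [hsum]
    rw [evalP, map_sum]
    exact Finset.sum_congr rfl fun k _ => (evalP_monomial _ _ _ (x, y)).1.symm
  have hm1 : ∑ k, v k * c k = 0 := by
    rw [← mul_zero y, ← he1]
    conv_rhs => rw [hsum]
    rw [evalP, map_sum, map_sum, Finset.mul_sum]
    exact Finset.sum_congr rfl fun k _ => (evalP_monomial _ _ _ (x, y)).2.1.symm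
  have hm2 : ∑ k, (v k ^ 2 - v k) * c k = 0 := by
    rw [← mul_zero (y ^ 2), ← he2]
    conv_rhs => rw [hsum]
    rw [evalP, map_sum, map_sum, map_sum, Finset.mul_sum]
    exact Finset.sum_congr rfl fun k _ => (evalP_monomial _ _ _ (x, y)).2.2.symm
  have hc := hw c (by
    rw [hT]
    intro r hr
    interval_cases r
    · simpa using hm0
    · simpa using hm1
    · simpa [sub_mul, Finset.sum_sub_distrib, hm1] using hm2)
  have hcoeff : (fun k : P => coeffAt f k.1) =
      fun t => aeval (Sum.elim (fun k : {k // k ∉ T} => c k) ![x⁻¹, y⁻¹]) (h t) := by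
    funext t
    simp only [h, map_mul, map_sum, map_pow, aeval_X, aeval_C, Sum.elim_inl, Sum.elim_inr,
      Algebra.algebraMap_self, RingHom.id_apply, ← hc t, c, Matrix.cons_val_zero,
      Matrix.cons_val_one, inv_pow]
    field_simp
  rw [hcoeff, ← coe_aeval_eq_eval, RingHom.coe_coe, ← comp_aeval_apply, hD, map_zero]

end
end

section
/- Call a finite set Q ⊂ ℤ² of class 𝒬₄ if Q has exactly 4 elements, some lattice translate of Q is contained in 3Δ ∩ ℤ², and for every nonzero polynomial g ∈ ℂ[x,y] whose support is a lattice translate of a subset of Q lying in [0,∞)², the zero set of g in the torus T contains no nondegenerate line. Let P ⊂ ℤ² ∩ [0,∞)² be a finite set containing a set Q of class 𝒬₄. Then for a generic polynomial f ∈ ℂ^P: for every nondegenerate line L and every point p ∈ L ∩ T, the intersection multiplicity of {f=0} and L at p is at most 3. -/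
open scoped Pointwise
open MvPolynomial

noncomputable section

/-- A four-point diagram of class `𝒬₄`. -/
def ClassQ4 (Q : Set (ℤ × ℤ)) : Prop :=
  Q.Finite ∧ Q.ncard = 4 ∧
  (∃ t : ℤ × ℤ, ∀ k ∈ Q, rpt (k + t) ∈ (3 : ℝ) • stdTriangle) ∧
  (∀ g : MvPolynomial (Fin 2) ℂ, g ≠ 0 →
    (∃ t : ℤ × ℤ, ∀ m ∈ g.support, ((m 0 : ℤ) - t.1, (m 1 : ℤ) - t.2) ∈ Q) →
    ¬∃ a b : ℂ, a ≠ 0 ∧ b ≠ 0 ∧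
      {p | p ∈ Torus ∧ a * p.1 + b * p.2 + 1 = 0} ⊆ {p : ℂ × ℂ | evalP g p = 0})

/-- A family of more polynomials than there are variables is algebraically dependent. -/
lemma exists_aeval_eq_zero_of_card_lt {ι κ : Type} [Fintype ι] [Fintype κ]
    (h : Fintype.card κ < Fintype.card ι) (F : ι → MvPolynomial κ ℂ) :
    ∃ D : MvPolynomial ι ℂ, D ≠ 0 ∧ aeval F D = 0 := by
  by_contra! hD
  have hind : AlgebraicIndependent ℂ F :=
    algebraicIndependent_iff.2 fun p hp => by_contra fun hne => hD p hne hp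
  have := hind.lift_cardinalMk_le_trdeg
  rw [MvPolynomial.trdeg_of_isDomain] at this
  simp at this
  omega

/-- If a linear system, depending polynomially on fewer parameters than it has equations, is
nondegenerate in the unknowns `α`, then the coefficient vectors solving it for some parameter
satisfy a nontrivial polynomial equation. -/
lemma exists_ne_zero_eval_eq_zero_of_mulVec {σ α β : Type} [Fintype σ] [Fintype α] [DecidableEq α]
    [Fintype β] (hcard : Fintype.card σ < Fintype.card α)
    (A : Matrix α α (MvPolynomial σ ℂ)) (B : Matrix α β (MvPolynomial σ ℂ)) :
    ∃ D : MvPolynomial (α ⊕ β) ℂ, D ≠ 0 ∧ ∀ (z : σ → ℂ) (c : α → ℂ) (d : β → ℂ),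
      (A.map (eval z)).det ≠ 0 → (A.map (eval z)).mulVec c + (B.map (eval z)).mulVec d = 0 →
        eval (Sum.elim c d) D = 0 := by
  let ρ : MvPolynomial σ ℂ →+* MvPolynomial (σ ⊕ β) ℂ := (rename Sum.inl).toRingHom
  let F : α ⊕ β → MvPolynomial (σ ⊕ β) ℂ := Sum.elim
    (fun i => -((A.map ρ).adjugate.mulVec ((B.map ρ).mulVec fun j => X (Sum.inr j))) i)
    (fun j => (A.map ρ).det * X (Sum.inr j))
  obtain ⟨D, hD, hF⟩ := exists_aeval_eq_zero_of_card_lt (by simp; omega) F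
  refine ⟨D, hD, fun z c d hdet hsol => ?_⟩
  set A' := A.map (eval z)
  set B' := B.map (eval z)
  let φ : MvPolynomial (σ ⊕ β) ℂ →+* ℂ := eval (Sum.elim z fun j => A'.det⁻¹ * d j)
  have hρ (q) : φ (ρ q) = eval z q := by
    simp only [φ, ρ, AlgHom.toRingHom_eq_coe, RingHom.coe_coe, eval_rename, Sum.elim_comp_inl]
  have hA : φ.mapMatrix (A.map ρ) = A' := by ext; simp [A', hρ]
  have hB : (B.map ρ).map φ = B' := by ext; simp [B', hρ]
  have key : (fun i => φ (F i)) = Sum.elim c d := by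
    funext i
    rcases i with i | j
    · have hX : (φ ∘ fun j => X (Sum.inr j)) = A'.det⁻¹ • d := by
        ext; simp [φ]
      have hBX : (φ ∘ (B.map ρ).mulVec fun j => X (Sum.inr j)) =
          B'.mulVec (A'.det⁻¹ • d) := by
        ext; simp only [Function.comp_apply, RingHom.map_mulVec, hB, ← hX]
      have h1 : φ (F (Sum.inl i)) = -(A'.adjugate.mulVec (B'.mulVec (A'.det⁻¹ • d))) i := by
        simp only [F, Sum.elim_inl, map_neg, RingHom.map_mulVec, hBX]
        rw [← hA, ← RingHom.map_adjugate]
        rfl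
      have h2 : B'.mulVec d = -A'.mulVec c := eq_neg_of_add_eq_zero_right hsol
      rw [h1, Matrix.mulVec_smul, h2, Matrix.mulVec_smul,
        Matrix.mulVec_neg, Matrix.mulVec_mulVec, Matrix.adjugate_mul]
      simp [Matrix.smul_mulVec, hdet]
    · have : φ (A.map ρ).det = A'.det := by rw [RingHom.map_det, hA]
      simp only [F, Sum.elim_inr, map_mul, this]
      simp [φ, hdet]
  have hcomp : φ.comp (algebraMap ℂ (MvPolynomial (σ ⊕ β) ℂ)) = RingHom.id ℂ := by
    ext; simp [φ, algebraMap_eq]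
  have := congrArg φ hF
  rw [map_zero, aeval_def, hom_eval₂, hcomp] at this
  rw [← this, ← key]
  rfl

/-- The restriction of the monomial with exponent `k` to the parametrized line
`t ↦ (x + t, y + s * t)`. -/
def lineMonomial {R : Type*} [CommRing R] (x y s : R) (k : ℤ × ℤ) : Polynomial R :=
  (Polynomial.C x + Polynomial.X) ^ k.1.toNat *
    (Polynomial.C y + Polynomial.C s * Polynomial.X) ^ k.2.toNat

lemma lineMonomial_map {R S : Type*} [CommRing R] [CommRing S] (φ : R →+* S) (x y s : R)
    (k : ℤ × ℤ) : (lineMonomial x y s k).map φ = lineMonomial (φ x) (φ y) (φ s) k := by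
  simp [lineMonomial]

/-- The exponent in `ℕ²` of a lattice point. -/
def expo (k : ℤ × ℤ) : Fin 2 →₀ ℕ :=
  Finsupp.single 0 k.1.toNat + Finsupp.single 1 k.2.toNat

lemma expo_injOn : Set.InjOn expo {k | 0 ≤ k.1 ∧ 0 ≤ k.2} := by
  intro k hk l hl h
  simp only [Set.mem_ofPred_eq] at hk hl
  have h0 := DFunLike.congr_fun h 0
  have h1 := DFunLike.congr_fun h 1
  simp [expo] at h0 h1
  ext <;> omega

lemma lineRestrict_monomial (x y s : ℂ) (k : ℤ × ℤ) (c : ℂ) :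
    lineRestrict (monomial (expo k) c) (x, y) (1, s) = Polynomial.C c * lineMonomial x y s k := by
  simp [lineRestrict, aeval_monomial, lineMonomial, expo, Finsupp.prod_fintype]

lemma eq_sum_monomial_coeffAt {P : Set (ℤ × ℤ)} [Fintype P] (hpos : ∀ k ∈ P, 0 ≤ k.1 ∧ 0 ≤ k.2)
    {f : MvPolynomial (Fin 2) ℂ} (hf : SuppIn f P) :
    f = ∑ k : P, monomial (expo k) (coeffAt f k) := by
  classical
  have hcoeff (k : P) : coeffAt f k = coeff (expo k) f := if_pos (hpos k k.2)
  have hexpo (m : Fin 2 →₀ ℕ) : expo ((m 0 : ℤ), (m 1 : ℤ)) = m := by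
    ext i
    fin_cases i <;> simp [expo]
  ext m
  simp only [coeff_sum, coeff_monomial, hcoeff]
  by_cases hm : ((m 0 : ℤ), (m 1 : ℤ)) ∈ P
  · rw [Finset.sum_eq_single ⟨_, hm⟩]
    · simp [hexpo]
    · intro k _ hk
      rw [if_neg]
      intro hkm
      exact hk (Subtype.ext (expo_injOn (hpos k k.2) (hpos _ hm) (hkm.trans (hexpo m).symm)))
    · simp
  · have hm0 : coeff m f = 0 := by
      by_contra hne
      exact hm (hf m (mem_support_iff.2 hne))
    rw [hm0, Finset.sum_eq_zero]
    intro k _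
    split_ifs with hkm
    · rw [hkm, hm0]
    · rfl

lemma lineRestrict_eq_sum {P : Set (ℤ × ℤ)} [Fintype P] (hpos : ∀ k ∈ P, 0 ≤ k.1 ∧ 0 ≤ k.2)
    {f : MvPolynomial (Fin 2) ℂ} (hf : SuppIn f P) (x y s : ℂ) :
    lineRestrict f (x, y) (1, s) =
      ∑ k : P, Polynomial.C (coeffAt f k) * lineMonomial x y s k := by
  conv_lhs => rw [eq_sum_monomial_coeffAt hpos hf]
  rw [lineRestrict, map_sum]
  exact Finset.sum_congr rfl fun k _ => lineRestrict_monomial x y s k _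

lemma lineRestrict_eq_comp (f : MvPolynomial (Fin 2) ℂ) (p : ℂ × ℂ) {a b : ℂ} (hb : b ≠ 0) :
    lineRestrict f p (b, -a) =
      (lineRestrict f p (1, -a / b)).comp (Polynomial.C b * Polynomial.X) := by
  have : lineRestrict f p (b, -a) =
      ((Polynomial.aeval (R := ℂ) (Polynomial.C b * Polynomial.X)).comp
        (aeval fun i : Fin 2 =>
          if i = 0 then Polynomial.C p.1 + Polynomial.C 1 * Polynomial.X
          else Polynomial.C p.2 + Polynomial.C (-a / b) * Polynomial.X)) f := by
    rw [lineRestrict]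
    congr 1
    ext i : 1
    fin_cases i
    · simp
    · simp [← mul_assoc, ← Polynomial.C_mul, hb]
  rw [this]
  rfl

lemma coeff_eq_zero_of_three_lt_interMult {f : MvPolynomial (Fin 2) ℂ} {p : ℂ × ℂ} {a b : ℂ}
    (hb : b ≠ 0) (h : ¬ interMult f p (b, -a) ≤ 3) :
    ∀ d < 4, (lineRestrict f p (1, -a / b)).coeff d = 0 := by
  have key : Polynomial.X ^ 4 ∣ lineRestrict f p (b, -a) := by
    by_cases h0 : lineRestrict f p (b, -a) = 0
    · simp [h0]
    · rw [interMult, if_neg h0] at h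
      have h4 : 4 ≤ Polynomial.rootMultiplicity 0 (lineRestrict f p (b, -a)) := by
        by_contra hlt
        exact h (by exact_mod_cast Nat.le_of_lt_succ (not_le.1 hlt))
      simpa using (Polynomial.le_rootMultiplicity_iff h0).1 h4
  intro d hd
  have := Polynomial.X_pow_dvd_iff.1 key d hd
  rw [lineRestrict_eq_comp f p hb, Polynomial.comp_C_mul_X_coeff] at this
  simpa [hb] using this

lemma mem_three_stdTriangle {k : ℤ × ℤ} (h : rpt k ∈ (3 : ℝ) • stdTriangle) :
    0 ≤ k.1 ∧ 0 ≤ k.2 ∧ k.1 + k.2 ≤ 3 := by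
  obtain ⟨q, hq, hqk⟩ := h
  have hsub : stdTriangle ⊆ {q : ℝ × ℝ | 0 ≤ q.1 ∧ 0 ≤ q.2 ∧ q.1 + q.2 ≤ 1} := by
    refine convexHull_min ?_ ?_
    · rintro q (rfl | rfl | rfl) <;> norm_num
    · rintro u ⟨h1, h2, h3⟩ v ⟨h4, h5, h6⟩ r t hr ht hrt
      simp only [Set.mem_ofPred_eq, Prod.fst_add, Prod.snd_add, Prod.smul_fst, Prod.smul_snd,
        smul_eq_mul]
      refine ⟨by positivity, by positivity, by nlinarith⟩
  obtain ⟨h1, h2, h3⟩ := hsub hq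
  have e1 : 3 * q.1 = k.1 := congrArg Prod.fst hqk
  have e2 : 3 * q.2 = k.2 := congrArg Prod.snd hqk
  refine ⟨?_, ?_, ?_⟩
  · exact_mod_cast (by linarith : (0 : ℝ) ≤ k.1)
  · exact_mod_cast (by linarith : (0 : ℝ) ≤ k.2)
  · exact_mod_cast (by linarith : (k.1 + k.2 : ℝ) ≤ 3)

lemma eval_lineRestrict (f : MvPolynomial (Fin 2) ℂ) (p w : ℂ × ℂ) (t : ℂ) :
    (lineRestrict f p w).eval t = evalP f (p.1 + w.1 * t, p.2 + w.2 * t) := by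
  have hcomp : (Polynomial.evalRingHom t).comp (algebraMap ℂ (Polynomial ℂ)) = RingHom.id ℂ := by
    ext; simp
  rw [← Polynomial.coe_evalRingHom, lineRestrict, aeval_def, hom_eval₂, hcomp, evalP, eval,
    coe_eval₂Hom]
  congr 1
  funext i
  fin_cases i <;> simp

lemma lineMonomial_mul_eq {R : Type*} [CommRing R] (x y s : R) {k l m n : ℤ × ℤ}
    (h₁ : k.1.toNat + l.1.toNat = m.1.toNat + n.1.toNat)
    (h₂ : k.2.toNat + l.2.toNat = m.2.toNat + n.2.toNat) :
    lineMonomial x y s k * lineMonomial x y s l = lineMonomial x y s m * lineMonomial x y s n := by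
  simp only [lineMonomial]
  rw [mul_mul_mul_comm, ← pow_add, ← pow_add, h₁, h₂, pow_add, pow_add, mul_mul_mul_comm]

lemma natDegree_lineMonomial_le (x y s : ℂ) (k : ℤ × ℤ) :
    (lineMonomial x y s k).natDegree ≤ k.1.toNat + k.2.toNat := by
  unfold lineMonomial
  compute_degree

lemma isCoprime_X_linear {y : ℂ} (hy : y ≠ 0) (s : ℂ) :
    IsCoprime (Polynomial.X : Polynomial ℂ) (Polynomial.C y + Polynomial.C s * Polynomial.X) := by
  refine ⟨-Polynomial.C s * Polynomial.C y⁻¹, Polynomial.C y⁻¹, ?_⟩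
  have : Polynomial.C y⁻¹ * Polynomial.C y = 1 := by rw [← Polynomial.C_mul]; simp [hy]
  linear_combination this

lemma isCoprime_X_lineMonomial {x y : ℂ} (hx : x ≠ 0) (hy : y ≠ 0) (s : ℂ) (k : ℤ × ℤ) :
    IsCoprime (Polynomial.X : Polynomial ℂ) (lineMonomial x y s k) :=
  IsCoprime.mul_right (by simpa using (isCoprime_X_linear hx 1).pow_right)
    (isCoprime_X_linear hy s).pow_right

/-- No nonzero polynomial supported in a diagram of class `𝒬₄` meets a nondegenerate line with
multiplicity at least four at a point of the torus. -/
lemma ClassQ4.eq_zero_of_coeff_eq_zero {Q : Set (ℤ × ℤ)} [Fintype Q] (hQ : ClassQ4 Q)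
    (hpos : ∀ k ∈ Q, 0 ≤ k.1 ∧ 0 ≤ k.2) {a b : ℂ} (ha : a ≠ 0) (hb : b ≠ 0) {x y : ℂ}
    (hx : x ≠ 0) (hy : y ≠ 0) (hline : a * x + b * y + 1 = 0) (c : Q → ℂ)
    (h : ∀ d < 4, (∑ k : Q, Polynomial.C (c k) * lineMonomial x y (-a / b) k).coeff d = 0) :
    c = 0 := by
  classical
  obtain ⟨-, -, ⟨t, ht⟩, hno⟩ := hQ
  by_contra hc
  obtain ⟨k₀, hk₀⟩ := Function.ne_iff.1 hc
  have htri (k : Q) := mem_three_stdTriangle (ht k k.2)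
  set g : MvPolynomial (Fin 2) ℂ := ∑ k : Q, monomial (expo (k + t)) (c k) with hg
  have hgne : g ≠ 0 := by
    intro h0
    apply hk₀
    have h1 := congrArg (coeff (expo (k₀ + t))) h0
    rw [hg, coeff_sum, Finset.sum_eq_single k₀] at h1
    · simpa using h1
    · intro k _ hk
      rw [coeff_monomial, if_neg]
      intro he
      have := expo_injOn ⟨(htri k).1, (htri k).2.1⟩ ⟨(htri k₀).1, (htri k₀).2.1⟩ he
      exact hk (Subtype.ext (add_right_cancel this))
    · simp
  refine hno g hgne ⟨t, fun m hm => ?_⟩ ⟨a, b, ha, hb, ?_⟩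
  · obtain ⟨k, -, hk⟩ := Finset.mem_biUnion.1 (support_sum hm)
    have hmk : m = expo (k + t) := by simpa using support_monomial_subset hk
    obtain ⟨h1, h2, -⟩ := htri k
    simp only [Prod.fst_add, Prod.snd_add] at h1 h2
    have hkm : ((m 0 : ℤ) - t.1, (m 1 : ℤ) - t.2) = (k : ℤ × ℤ) := by
      rw [hmk]
      ext <;> simp [expo, h1, h2]
    rw [hkm]
    exact k.2
  · have hres : lineRestrict g (x, y) (1, -a / b) =
        ∑ k : Q, Polynomial.C (c k) * lineMonomial x y (-a / b) (k + t) := by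
      rw [lineRestrict, hg, map_sum]
      exact Finset.sum_congr rfl fun k _ => lineRestrict_monomial x y _ _ _
    have hmul : lineMonomial x y (-a / b) (-t) * lineRestrict g (x, y) (1, -a / b) =
        lineMonomial x y (-a / b) t *
          ∑ k : Q, Polynomial.C (c k) * lineMonomial x y (-a / b) k := by
      rw [hres, Finset.mul_sum, Finset.mul_sum]
      refine Finset.sum_congr rfl fun k _ => ?_
      rw [mul_left_comm, mul_left_comm _ (Polynomial.C _)]
      obtain ⟨h1, h2, -⟩ := htri k
      obtain ⟨h3, h4⟩ := hpos k k.2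
      simp only [Prod.fst_add, Prod.snd_add] at h1 h2
      congr 1
      apply lineMonomial_mul_eq
      · simp only [Prod.fst_add, Prod.fst_neg]; omega
      · simp only [Prod.snd_add, Prod.snd_neg]; omega
    have hdvd : Polynomial.X ^ 4 ∣ lineRestrict g (x, y) (1, -a / b) := by
      refine (isCoprime_X_lineMonomial hx hy (-a / b) (-t)).pow_left.dvd_of_dvd_mul_left ?_
      rw [hmul]
      exact (Polynomial.X_pow_dvd_iff.2 h).mul_left _
    have hzero : lineRestrict g (x, y) (1, -a / b) = 0 := by
      refine Polynomial.eq_zero_of_dvd_of_natDegree_lt hdvd ?_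
      rw [Polynomial.natDegree_X_pow, Nat.lt_succ_iff, hres]
      refine Polynomial.natDegree_sum_le_of_forall_le _ _ fun k _ => ?_
      refine (Polynomial.natDegree_C_mul_le _ _).trans
        ((natDegree_lineMonomial_le _ _ _ _).trans ?_)
      have := htri k
      omega
    rintro ⟨u, v⟩ ⟨-, huv⟩
    have := eval_lineRestrict g (x, y) (1, -a / b) (u - x)
    rw [hzero, Polynomial.eval_zero] at this
    rw [Set.mem_ofPred_eq, this]
    congr 2
    · simp
    · simp only at huv ⊢
      field_simp
      linear_combination huv - hline

theorem mult_at_most_three (P : Set (ℤ × ℤ)) (hfin : P.Finite)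
    (hpos : ∀ k ∈ P, 0 ≤ k.1 ∧ 0 ≤ k.2)
    (Q : Set (ℤ × ℤ)) (hQ : ClassQ4 Q) (hQP : Q ⊆ P) :
    GenericOn P (fun f =>
      ∀ a b : ℂ, a ≠ 0 → b ≠ 0 → ∀ p ∈ Torus, a * p.1 + b * p.2 + 1 = 0 →
        interMult f p (b, -a) ≤ 3) := by
  classical
  have : Fintype P := hfin.fintype
  have : Fintype Q := hQ.1.fintype
  have : Fintype (P \ Q : Set (ℤ × ℤ)) := (hfin.sdiff).fintype
  have hcard : Fintype.card Q = 4 := by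
    rw [← Nat.card_eq_fintype_card]; exact hQ.2.1
  let e : Q ≃ Fin 4 := Fintype.equivFinOfCardEq hcard
  let M (i : Q) (k : ℤ × ℤ) : MvPolynomial (Fin 3) ℂ :=
    (lineMonomial (X 0) (X 1) (X 2) k).coeff (e i)
  have hM (z : Fin 3 → ℂ) (i : Q) (k : ℤ × ℤ) :
      eval z (M i k) = (lineMonomial (z 0) (z 1) (z 2) k).coeff (e i) := by
    simp only [M, ← Polynomial.coeff_map, lineMonomial_map, eval_X]
  obtain ⟨D, hD, hvanish⟩ := exists_ne_zero_eval_eq_zero_of_mulVec (by simp [hcard])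
    (Matrix.of fun i k : Q => M i k) (Matrix.of fun (i : Q) (k : (P \ Q : Set (ℤ × ℤ))) => M i k)
  let E := Equiv.Set.sumDiffSubset hQP
  refine ⟨rename E D, fun h0 => hD (rename_injective E E.injective (by simpa using h0)),
    fun f hf hDf a b ha hb p hp hline => ?_⟩
  obtain ⟨hx, hy⟩ := hp
  by_contra hmult
  have hcoeff := coeff_eq_zero_of_three_lt_interMult hb hmult
  rw [lineRestrict_eq_sum hpos hf] at hcoeff
  apply hDf
  have hsplit : (fun k : P => coeffAt f k.1) ∘ E =
      Sum.elim (fun k : Q => coeffAt f k) (fun k : (P \ Q : Set (ℤ × ℤ)) => coeffAt f k) := by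
    funext k
    rcases k with k | k <;> rfl
  rw [eval_rename, hsplit]
  apply hvanish ![p.1, p.2, -a / b]
  · intro hdet
    obtain ⟨v, hv, hv0⟩ := Matrix.exists_mulVec_eq_zero_iff.2 hdet
    refine hv (hQ.eq_zero_of_coeff_eq_zero (fun k hk => hpos k (hQP hk)) ha hb hx hy hline v ?_)
    intro d hd
    have := congrFun hv0 (e.symm ⟨d, hd⟩)
    simpa [Matrix.mulVec, dotProduct, hM, Polynomial.finsetSum_coeff, mul_comm] using this
  · funext i
    have := hcoeff (e i) (e i).2
    rw [← E.sum_comp, Fintype.sum_sum_type] at this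
    simpa [Matrix.mulVec, dotProduct, hM, Polynomial.finsetSum_coeff, mul_comm, E] using this

end
end
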